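/- arXiv:1001.4888 — 2 statements merged into one kernel-verified Lean document; each statement's English description precedes it below -/
import Mathlib

section
/- Let T = 2^{<ω} be the dyadic tree, let I_0 and I_1 be the ideals on T generated by {a_x^0 : x ∈ 2^ω} and {a_x^1 : x ∈ 2^ω} respectively, and let J be the ideal on T generated by the antichains of T. Then I_0, I_1, J are pairwise orthogonal and form a 3-gap which is not weakly countably separated. -/
/-- An ideal on a countable set `E`: contains all finite sets, closed under
finite unions and subsets. -/
def IsIdeal {E : Type*} (I : Set (Set E)) : Prop :=
  (∀ s : Set E, s.Finite → s ∈ I) ∧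
  (∀ a ∈ I, ∀ b ∈ I, a ∪ b ∈ I) ∧
  (∀ a ∈ I, ∀ b : Set E, b ⊆ a → b ∈ I)

/-- Two families of sets are orthogonal (mod finite). -/
def Orth {E : Type*} (I J : Set (Set E)) : Prop := ∀ a ∈ I, ∀ b ∈ J, (a ∩ b).Finite

/-- `I ≤ c` mod finite: every member of `I` is almost contained in `c`. -/
def IdealLe {E : Type*} (I : Set (Set E)) (c : Set E) : Prop := ∀ x ∈ I, (x \ c).Finite

/-- `b ∈ I^⊥`: `b` has finite intersection with every member of `I`. -/
def InPerp {E : Type*} (b : Set E) (I : Set (Set E)) : Prop := ∀ x ∈ I, (b ∩ x).Finite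

/-- The restriction `I|_a = {x ∈ I : x \ a finite}`. -/
def Restrict {E : Type*} (I : Set (Set E)) (a : Set E) : Set (Set E) :=
  {x ∈ I | (x \ a).Finite}

/-- The family `{I_i : i ∈ A}` is a multiple gap: pairwise orthogonal and for any
sets `c i` with `I i ≤ c i` (for `i ∈ A`), the intersection `⋂ i ∈ A, c i` is infinite. -/
def MultiGap {E : Type*} {n : ℕ} (A : Set (Fin n)) (I : Fin n → Set (Set E)) : Prop :=
  (∀ i ∈ A, ∀ j ∈ A, i ≠ j → Orth (I i) (I j)) ∧
  ∀ c : Fin n → Set E, (∀ i ∈ A, IdealLe (I i) (c i)) → (⋂ i ∈ A, c i).Infinite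

/-- An `n`-gap: a multiple gap indexed by all of `n`. -/
def IsGap {E : Type*} {n : ℕ} (I : Fin n → Set (Set E)) : Prop := MultiGap Set.univ I

/-- `{I_i : i < n}` is a `B`-jigsaw. -/
def IsBJigsaw {E : Type*} {n : ℕ} (I : Fin n → Set (Set E)) (B : Set (Fin n)) : Prop :=
  ∀ A : Set (Fin n), B ⊆ A → ∀ a : Set E,
    MultiGap A (fun i => Restrict (I i) a) →
    ∃ b : Set E, b ⊆ a ∧ MultiGap B (fun i => Restrict (I i) b) ∧
      ∀ i ∈ A \ B, InPerp b (I i)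

/-- `{I_i : i < n}` is a `B`-clover. -/
def IsBClover {E : Type*} {n : ℕ} (I : Fin n → Set (Set E)) (B : Set (Fin n)) : Prop :=
  ¬ ∃ b : Set E, MultiGap B (fun i => Restrict (I i) b) ∧
      ∀ i ∈ Set.univ \ B, InPerp b (I i)

/-- Weak countable separation. -/
def WeaklyCS {E : Type*} {n : ℕ} (I : Fin n → Set (Set E)) : Prop :=
  ∃ c : Fin n → ℕ → Set E,
    (∀ k, (⋂ i, c i k).Finite) ∧
    ∀ x : Fin n → Set E, (∀ i, x i ∈ I i) → ∃ k, ∀ i, (x i \ c i k).Finite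

/-- Strong countable separation. -/
def StronglyCS {E : Type*} {n : ℕ} (I : Fin n → Set (Set E)) : Prop :=
  ∃ c : Fin n → ℕ → Set E,
    (∀ k, ∀ i j : Fin n, i ≠ j → (c i k ∩ c j k).Finite) ∧
    ∀ x : Fin n → Set E, (∀ i, x i ∈ I i) → ∃ k, ∀ i, (x i \ c i k).Finite

/-- The ideal generated by a family `G` of subsets of `E`: all sets almost covered by
finitely many members of `G`. -/
def GenIdeal {E : Type*} (G : Set (Set E)) : Set (Set E) :=
  {b | ∃ F : Finset (Set E), ↑F ⊆ G ∧ (b \ ⋃₀ ↑F).Finite}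

/-- `s` is an initial segment of the branch `x ∈ n^ω`. -/
def IsInitSeg {n : ℕ} (s : List (Fin n)) (x : ℕ → Fin n) : Prop :=
  ∀ k : ℕ, ∀ h : k < s.length, s.get ⟨k, h⟩ = x k

/-- `a_x^i = {s ∈ n^{<ω} : s⌢i is an initial segment of x}`. -/
def sideSet {n : ℕ} (x : ℕ → Fin n) (i : Fin n) : Set (List (Fin n)) :=
  {s | IsInitSeg (s ++ [i]) x}

/-- The ideal `J_i` on the `n`-ary tree generated by the sets `a_x^i`, `x ∈ n^ω`. -/
def treeIdeal (n : ℕ) (i : Fin n) : Set (Set (List (Fin n))) :=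
  GenIdeal {a | ∃ x : ℕ → Fin n, a = sideSet x i}

/-- The three ideals on the dyadic tree: `I_0`, `I_1` generated by the sets `a_x^0`, `a_x^1`
for branches `x ∈ 2^ω`, and `I_2 = J` generated by the antichains of `T = 2^{<ω}`
(with respect to the end-extension order, i.e. the prefix order). -/
def dyadicIdeal : Fin 3 → Set (Set (List (Fin 2)))
  | 0 => treeIdeal 2 0
  | 1 => treeIdeal 2 1
  | 2 => GenIdeal {a : Set (List (Fin 2)) | IsAntichain (· <+: ·) a}

theorem Orth.symm {E : Type*} {I J : Set (Set E)} (h : Orth I J) : Orth J I := by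
  intro a ha b hb
  rw [Set.inter_comm]
  exact h b hb a ha

theorem Orth.genIdeal {E : Type*} {G H : Set (Set E)} (h : Orth G H) :
    Orth (GenIdeal G) (GenIdeal H) := by
  rintro a ⟨F, hF, haF⟩ b ⟨K, hK, hbK⟩
  have hU : (⋃ f ∈ F, ⋃ g ∈ K, f ∩ g).Finite :=
    F.finite_toSet.biUnion fun f hf => K.finite_toSet.biUnion fun g hg => h f (hF hf) g (hK hg)
  refine ((haF.union hbK).union hU).subset ?_
  rintro s ⟨hsa, hsb⟩
  by_cases h₁ : s ∈ ⋃₀ (F : Set (Set E))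
  · by_cases h₂ : s ∈ ⋃₀ (K : Set (Set E))
    · obtain ⟨f, hf, hsf⟩ := h₁
      obtain ⟨g, hg, hsg⟩ := h₂
      right
      simp only [Set.mem_iUnion]
      exact ⟨f, hf, g, hg, hsf, hsg⟩
    · exact Or.inl (Or.inr ⟨hsb, h₂⟩)
  · exact Or.inl (Or.inl ⟨hsa, h₁⟩)

theorem subset_genIdeal {E : Type*} {G : Set (Set E)} {a : Set E} (ha : a ∈ G) :
    a ∈ GenIdeal G :=
  ⟨{a}, by simpa using ha, by simp⟩

section InitialSegments

variable {n : ℕ}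

theorem isInitSeg_concat {s : List (Fin n)} {i : Fin n} {x : ℕ → Fin n} :
    IsInitSeg (s ++ [i]) x ↔ IsInitSeg s x ∧ x s.length = i := by
  constructor
  · intro h
    refine ⟨fun k hk => ?_, ?_⟩
    · have := h k (by simp; omega)
      simpa [List.getElem_append_left hk] using this
    · have := h s.length (by simp)
      simpa using this.symm
  · rintro ⟨h, hi⟩ k hk
    rcases Nat.lt_or_ge k s.length with hks | hks
    · simpa [List.getElem_append_left hks] using h k hks
    · obtain rfl : k = s.length := by simp at hk; omega
      simpa using hi.symm

theorem IsInitSeg.of_prefix {s t : List (Fin n)} {x : ℕ → Fin n} (ht : IsInitSeg t x)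
    (h : s <+: t) : IsInitSeg s x := by
  intro k hk
  have := ht k (hk.trans_le h.length_le)
  rw [← this]
  simpa using h.getElem hk

theorem IsInitSeg.prefix_of_length_le {s t : List (Fin n)} {x : ℕ → Fin n} (hs : IsInitSeg s x)
    (ht : IsInitSeg t x) (h : s.length ≤ t.length) : s <+: t := by
  rw [List.prefix_iff_eq_take]
  refine List.ext_getElem (by simpa using h) fun k hk _ => ?_
  have h₁ := hs k hk
  have h₂ := ht k (hk.trans_le h)
  simp only [List.get_eq_getElem] at h₁ h₂
  simp [h₁, h₂]

theorem exists_isInitSeg_length (x : ℕ → Fin n) (m : ℕ) :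
    ∃ s : List (Fin n), IsInitSeg s x ∧ s.length = m :=
  ⟨(List.range m).map x, fun k hk => by simp, by simp⟩

theorem sideSet_inter_sideSet_finite (x y : ℕ → Fin n) {i j : Fin n} (hij : i ≠ j) :
    (sideSet x i ∩ sideSet y j).Finite := by
  have key : ∀ s ∈ sideSet x i ∩ sideSet y j, ∀ t ∈ sideSet x i ∩ sideSet y j,
      t.length ≤ s.length := by
    rintro s ⟨hsx, hsy⟩ t ⟨htx, hty⟩
    by_contra! hlt
    have hx := (isInitSeg_concat.1 htx).1 _ hlt
    have hy := (isInitSeg_concat.1 hty).1 _ hlt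
    exact hij ((isInitSeg_concat.1 hsx).2.symm.trans
      (hx.symm.trans (hy.trans (isInitSeg_concat.1 hsy).2)))
  refine Set.Subsingleton.finite fun s hs t ht => ?_
  have hle := key t ht s hs
  have hpre := (isInitSeg_concat.1 hs.1).1.prefix_of_length_le (isInitSeg_concat.1 ht.1).1 hle
  exact hpre.eq_of_length (le_antisymm hle (key s hs t ht))

theorem sideSet_inter_antichain_finite (x : ℕ → Fin n) (i : Fin n) {a : Set (List (Fin n))}
    (ha : IsAntichain (· <+: ·) a) : (sideSet x i ∩ a).Finite := by
  refine Set.Subsingleton.finite fun s hs t ht => ?_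
  have hsx := (isInitSeg_concat.1 hs.1).1
  have htx := (isInitSeg_concat.1 ht.1).1
  rcases le_total s.length t.length with h | h
  · exact ha.eq hs.2 ht.2 (hsx.prefix_of_length_le htx h)
  · exact (ha.eq ht.2 hs.2 (htx.prefix_of_length_le hsx h)).symm

theorem orth_treeIdeal {i j : Fin n} (hij : i ≠ j) : Orth (treeIdeal n i) (treeIdeal n j) := by
  refine Orth.genIdeal ?_
  rintro _ ⟨x, rfl⟩ _ ⟨y, rfl⟩
  exact sideSet_inter_sideSet_finite x y hij

theorem orth_treeIdeal_antichain (i : Fin n) :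
    Orth (treeIdeal n i) (GenIdeal {a : Set (List (Fin n)) | IsAntichain (· <+: ·) a}) := by
  refine Orth.genIdeal ?_
  rintro _ ⟨x, rfl⟩ a ha
  exact sideSet_inter_antichain_finite x i ha

/-- The nodes that leave the branch `x` at their last entry. -/
def sideNodes (x : ℕ → Fin n) : Set (List (Fin n)) :=
  {u | ∃ s i, u = s ++ [i] ∧ IsInitSeg s x ∧ i ≠ x s.length}

theorem isAntichain_sideNodes (x : ℕ → Fin n) : IsAntichain (· <+: ·) (sideNodes x) := by
  rintro _ ⟨s, i, rfl, hs, hi⟩ _ ⟨t, j, rfl, ht, hj⟩ hne hpre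
  rcases List.prefix_concat_iff.1 hpre with h | h
  · exact hne h
  · exact hi (isInitSeg_concat.1 (ht.of_prefix h)).2.symm

theorem sideNodes_inter_cone_infinite {x : ℕ → Fin 2} {t : List (Fin 2)} (ht : IsInitSeg t x) :
    (sideNodes x ∩ {u | t <+: u}).Infinite := by
  choose p hp hlen using exists_isInitSeg_length x
  refine Set.infinite_of_injective_forall_mem
    (f := fun m => p (t.length + m) ++ [x (t.length + m) + 1]) ?_ ?_
  · intro m k h
    have := congrArg List.length h
    simpa [hlen] using this
  · intro m
    refine ⟨⟨_, _, rfl, hp _, ?_⟩, ?_⟩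
    · rw [hlen]
      generalize x (t.length + m) = y
      revert y
      decide
    · exact (ht.prefix_of_length_le (hp _) (by simp [hlen])).trans (List.prefix_append _ _)

/-- A strictly increasing sequence of nodes determines a branch. -/
theorem exists_branch [NeZero n] (t : ℕ → List (Fin n)) (ht : ∀ j, t j <+: t (j + 1))
    (hlen : ∀ j, j ≤ (t j).length) : ∃ x : ℕ → Fin n, ∀ j, IsInitSeg (t j) x := by
  have hmono : ∀ j k, j ≤ k → t j <+: t k := fun j k hjk => by
    induction hjk with
    | refl => exact List.prefix_rfl
    | step _ ih => exact ih.trans (ht _)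
  refine ⟨fun m => (t (m + 1)).getD m 0, fun j k hk => ?_⟩
  have hk' : k < (t (k + 1)).length := hlen (k + 1)
  simp only [List.get_eq_getElem, List.getD_eq_getElem _ _ hk']
  rcases le_total j (k + 1) with h | h
  · exact (hmono _ _ h).getElem hk
  · exact ((hmono _ _ h).getElem hk').symm

/-- A branch that is generic for countably many colourings: if almost all of it obeys the
`k`-th one, then an entire cone around the branch does. -/
theorem exists_generic_branch [NeZero n] (d : ℕ → Fin n → Set (List (Fin n))) :
    ∃ x : ℕ → Fin n, ∀ k, (∀ i, (sideSet x i \ d k i).Finite) →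
      ∃ t, IsInitSeg t x ∧ ∀ u, t <+: u → ∀ i, u ∈ d k i := by
  have step : ∀ (k : ℕ) (t : List (Fin n)), ∃ (s : List (Fin n)) (i : Fin n), t <+: s ∧
      ((∀ u, t <+: u → ∀ i, u ∈ d k i) ∨ s ∉ d k i) := by
    intro k t
    by_cases h : ∀ u, t <+: u → ∀ i, u ∈ d k i
    · exact ⟨t, 0, List.prefix_rfl, Or.inl h⟩
    · push Not at h
      obtain ⟨u, hu, i, hi⟩ := h
      exact ⟨u, i, hu, Or.inr hi⟩
  choose s e hs hd using step
  let t : ℕ → List (Fin n) :=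
    Nat.rec [] fun j u => s j.unpair.1 u ++ [e j.unpair.1 u]
  have ht : ∀ j, t (j + 1) = s j.unpair.1 (t j) ++ [e j.unpair.1 (t j)] := fun _ => rfl
  have hlen : ∀ j, j ≤ (t j).length := fun j => by
    induction j with
    | zero => exact Nat.zero_le _
    | succ j ih =>
      have := (hs j.unpair.1 (t j)).length_le
      rw [ht, List.length_append, List.length_singleton]
      omega
  obtain ⟨x, hx⟩ := exists_branch t
    (fun j => by rw [ht]; exact (hs _ _).trans (List.prefix_append _ _)) hlen
  refine ⟨x, fun k hfin => ?_⟩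
  obtain ⟨N, hN⟩ := ((Set.finite_iUnion hfin).image List.length).bddAbove
  refine ⟨t (Nat.pair k (N + 1)), hx _, (hd k _).resolve_right fun hbad => ?_⟩
  have hseg := hx (Nat.pair k (N + 1) + 1)
  rw [ht, Nat.unpair_pair] at hseg
  have h₁ : (s k (t (Nat.pair k (N + 1)))).length ≤ N :=
    hN (Set.mem_image_of_mem _ (Set.mem_iUnion.2 ⟨_, hseg, hbad⟩))
  have h₂ := (hs k (t (Nat.pair k (N + 1)))).length_le
  have h₃ := hlen (Nat.pair k (N + 1))
  have h₄ := Nat.right_le_pair k (N + 1)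
  omega

end InitialSegments

/-- A gap that is not weakly countably separated cannot be separated by a single tuple. -/
theorem isGap_of_not_weaklyCS {E : Type*} {n : ℕ} {I : Fin n → Set (Set E)}
    (horth : ∀ i j, i ≠ j → Orth (I i) (I j)) (h : ¬ WeaklyCS I) : IsGap I := by
  refine ⟨fun i _ j _ hij => horth i j hij, fun c hc => ?_⟩
  by_contra hfin
  rw [Set.not_infinite] at hfin
  exact h ⟨fun i _ => c i, fun _ => by simpa using hfin,
    fun x hx => ⟨0, fun i => hc i (Set.mem_univ i) (x i) (hx i)⟩⟩

theorem orth_dyadicIdeal (i j : Fin 3) (hij : i ≠ j) : Orth (dyadicIdeal i) (dyadicIdeal j) := by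
  have h01 : Orth (dyadicIdeal 0) (dyadicIdeal 1) := orth_treeIdeal (by decide)
  have h02 : Orth (dyadicIdeal 0) (dyadicIdeal 2) := orth_treeIdeal_antichain 0
  have h12 : Orth (dyadicIdeal 1) (dyadicIdeal 2) := orth_treeIdeal_antichain 1
  fin_cases i <;> fin_cases j
  exacts [absurd rfl hij, h01, h02, h01.symm, absurd rfl hij, h12, h02.symm, h12.symm,
    absurd rfl hij]

theorem not_weaklyCS_dyadicIdeal : ¬ WeaklyCS dyadicIdeal := by
  rintro ⟨c, hc, hsep⟩
  obtain ⟨x, hx⟩ := exists_generic_branch fun k => ![c 0 k, c 1 k]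
  obtain ⟨k, hk⟩ := hsep ![sideSet x 0, sideSet x 1, sideNodes x] (by
    intro i
    fin_cases i
    · exact subset_genIdeal ⟨x, rfl⟩
    · exact subset_genIdeal ⟨x, rfl⟩
    · exact subset_genIdeal (isAntichain_sideNodes x))
  obtain ⟨t, ht, hcone⟩ := hx k (by
    intro i
    fin_cases i
    · exact hk 0
    · exact hk 1)
  refine sideNodes_inter_cone_infinite ht (((hk 2).union (hc k)).subset ?_)
  rintro u ⟨hu, htu⟩
  by_cases h2 : u ∈ c 2 k
  · right
    rw [Set.mem_iInter]
    intro i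
    fin_cases i
    · exact hcone u htu 0
    · exact hcone u htu 1
    · exact h2
  · exact Or.inl ⟨hu, h2⟩

/-- `I_0`, `I_1` and the antichain ideal `J` on the dyadic tree are pairwise orthogonal
and form a 3-gap which is not weakly countably separated. -/
theorem dyadic_antichain_gap :
    (∀ i j : Fin 3, i ≠ j → Orth (dyadicIdeal i) (dyadicIdeal j)) ∧
    IsGap dyadicIdeal ∧
    ¬ WeaklyCS dyadicIdeal :=
  ⟨orth_dyadicIdeal, isGap_of_not_weaklyCS orth_dyadicIdeal not_weaklyCS_dyadicIdeal,
    not_weaklyCS_dyadicIdeal⟩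
end

section
/- Let L be a compact metric space, D ⊆ L countable, K = acc(D), and let {G_i : i < n} be pairwise disjoint subsets of K such that {I_{G_i} : i < n} is an n-gap. Then {I_{G_i} : i < n} is a jigsaw, i.e., a B-jigsaw for every nonempty proper subset B of n. -/
/-- The set of accumulation points of a subset of a metric space: points every
neighbourhood of which meets the set in infinitely many points. -/
def accPts {L : Type*} [MetricSpace L] (a : Set L) : Set L :=
  {x | ∀ ε : ℝ, 0 < ε → (Metric.ball x ε ∩ a).Infinite}

/-- For `G ⊆ acc(D)`, the ideal `I_G` on the countable set `D`: all `a ⊆ D` whose set of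
accumulation points (computed in `L`) is contained in `G`. -/
def idealIG {L : Type*} [MetricSpace L] (D : Set L) (G : Set L) : Set (Set ↥D) :=
  {a : Set ↥D | accPts (Subtype.val '' a) ⊆ G}

open Set Filter Topology

theorem accPts_eq_derivedSet {L : Type*} [MetricSpace L] (a : Set L) :
    accPts a = derivedSet a := by
  ext x
  constructor
  · intro h
    rw [mem_derivedSet, accPt_iff_nhds]
    intro U hU
    obtain ⟨ε, hε, hsub⟩ := Metric.mem_nhds_iff.1 hU
    obtain ⟨y, hy, hne⟩ := (h ε hε).exists_notMem_finite (finite_singleton x)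
    exact ⟨y, ⟨hsub hy.1, hy.2⟩, hne⟩
  · intro h ε hε
    exact Set.Infinite.of_accPt (AccPt.nhds_inter h (Metric.ball_mem_nhds x hε))

/-- `ChainPt G b S x`: `x` is an iterated limit of points of `b`, along a chain that passes
through each `G i` with `i ∈ S`. -/
inductive ChainPt {ι L : Type*} [DecidableEq ι] [TopologicalSpace L] (G : ι → Set L)
    (b : Set L) : Finset ι → L → Prop
  | base {x : L} : x ∈ b → ChainPt G b ∅ x
  | limit {S : Finset ι} {x : L} {i : ι} {y : ℕ → L} :
      x ∈ G i → (∀ k, y k ≠ x) → Tendsto y atTop (𝓝 x) → (∀ k, ChainPt G b S (y k)) →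
      ChainPt G b (insert i S) x

namespace ChainPt

variable {ι L : Type*} [DecidableEq ι]

theorem mono [TopologicalSpace L] {G : ι → Set L} {b b' : Set L} (hb : b ⊆ b')
    {S : Finset ι} {x : L} (h : ChainPt G b S x) : ChainPt G b' S x := by
  induction h with
  | base hx => exact base (hb hx)
  | limit hx hne hy _ ih => exact limit hx hne hy ih

variable [MetricSpace L] {G : ι → Set L} {b : Set L} {S : Finset ι} {x : L}

theorem of_forall_exists {i : ι} (hx : x ∈ G i)
    (h : ∀ ε > 0, ∃ y, y ≠ x ∧ dist y x < ε ∧ ChainPt G b S y) :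
    ChainPt G b (insert i S) x := by
  choose y hne hd hc using fun k : ℕ => h (1 / ((k : ℝ) + 1)) Nat.one_div_pos_of_nat
  refine limit hx hne ?_ hc
  rw [tendsto_iff_dist_tendsto_zero]
  exact squeeze_zero (fun _ => dist_nonneg) (fun k => (hd k).le)
    tendsto_one_div_add_atTop_nhds_zero_nat

theorem exists_near_of_subset (h : ChainPt G b S x) :
    ∀ T ⊆ S, ∀ ε > 0, ∃ z, dist z x < ε ∧ ChainPt G b T z := by
  induction h with
  | base hx =>
    intro T hT ε hε
    rw [Finset.subset_empty.1 hT]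
    exact ⟨_, by simpa using hε, base hx⟩
  | @limit S x i y hx hne hy _ ih =>
    intro T hT ε hε
    have hnear : ∀ U ⊆ S, ∀ ε > 0, ∃ z, z ≠ x ∧ dist z x < ε ∧ ChainPt G b U z := by
      intro U hU ε hε
      obtain ⟨k, hk⟩ := ((Metric.tendsto_nhds.1 hy) (ε / 2) (half_pos hε)).exists
      have hpos : 0 < dist (y k) x := dist_pos.2 (hne k)
      obtain ⟨z, hz, hc⟩ := ih k U hU (dist (y k) x) hpos
      refine ⟨z, ?_, ?_, hc⟩
      · rintro rfl
        rw [dist_comm] at hz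
        exact lt_irrefl _ hz
      · linarith [dist_triangle z (y k) x]
    by_cases hi : i ∈ T
    · refine ⟨x, by simpa using hε, ?_⟩
      rw [← Finset.insert_erase hi]
      exact of_forall_exists hx (hnear _ (Finset.subset_insert_iff.1 hT))
    · obtain ⟨z, -, hz⟩ := hnear T ((Finset.subset_insert_iff_of_notMem hi).1 hT) ε hε
      exact ⟨z, hz⟩

/-- Below a chain point there is a subset of `b` all of whose accumulation points lie in the
sets the chain passes through, and which still witnesses the chain. -/
theorem exists_subset_derivedSet_subset (h : ChainPt G b S x) :
    ∀ ε > 0, ∃ b' ⊆ b, b' ⊆ Metric.ball x ε ∧ derivedSet b' ⊆ ⋃ i ∈ S, G i ∧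
      ChainPt G b' S x := by
  induction h with
  | @base x hx =>
    intro ε hε
    refine ⟨{x}, by simpa using hx, by simpa using hε, ?_, base rfl⟩
    intro z hz
    exact absurd (Set.Infinite.of_accPt hz) (by simp)
  | @limit S x i y hx hne hy _ ih =>
    intro ε hε
    have hlim : ∀ k : ℕ, ∃ m, dist (y m) x < min ε (1 / ((k : ℝ) + 1)) / 2 := fun k =>
      ((Metric.tendsto_nhds.1 hy) _
        (half_pos (lt_min hε Nat.one_div_pos_of_nat))).exists
    choose m hm using hlim
    choose c hcb hcball hcacc hcc using fun k : ℕ =>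
      ih (m k) (min ε (1 / ((k : ℝ) + 1)) / 2) (half_pos (lt_min hε Nat.one_div_pos_of_nat))
    have hc : ∀ k, ∀ z ∈ c k, dist z x < min ε (1 / ((k : ℝ) + 1)) := by
      intro k z hz
      have := Metric.mem_ball.1 (hcball k hz)
      linarith [dist_triangle z (y (m k)) x, hm k]
    refine ⟨⋃ k, c k, iUnion_subset hcb, ?_, ?_, ?_⟩
    · refine iUnion_subset fun k z hz => ?_
      exact (hc k z hz).trans_le (min_le_left _ _)
    · intro z hz
      by_cases hzx : z = x
      · exact mem_biUnion (Finset.mem_insert_self i S) (hzx ▸ hx)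
      · have hpos : 0 < dist z x := dist_pos.2 hzx
        obtain ⟨N, hN⟩ := exists_nat_one_div_lt (half_pos hpos)
        have hfin : z ∈ derivedSet (⋃ k ∈ Finset.range N, c k) := by
          refine (AccPt.nhds_inter hz (Metric.ball_mem_nhds z (half_pos hpos))).mono ?_
          rw [le_principal_iff, mem_principal]
          rintro w ⟨hw, hwc⟩
          obtain ⟨k, hk⟩ := mem_iUnion.1 hwc
          refine mem_biUnion (Finset.mem_coe.2 (Finset.mem_range.2 ?_)) hk
          by_contra hkN
          have h1 := (hc k w hk).trans_le (min_le_right _ _)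
          have h2 : 1 / ((k : ℝ) + 1) ≤ 1 / ((N : ℝ) + 1) :=
            Nat.one_div_le_one_div (not_lt.1 hkN)
          have h3 := Metric.mem_ball'.1 hw
          linarith [dist_triangle z w x]
        have hclosed : ∀ s : Finset ℕ, derivedSet (⋃ k ∈ s, c k) ⊆ ⋃ i ∈ S, G i := by
          intro s
          induction s using Finset.induction_on with
          | empty =>
            intro w hw
            exact absurd (Set.Infinite.of_accPt hw) (by simp)
          | insert k s _ ihs =>
            rw [Finset.set_biUnion_insert, derivedSet_union]
            exact union_subset (hcacc k) ihs
        exact biUnion_mono (Finset.subset_insert i S) (fun _ _ => Subset.rfl)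
          (hclosed _ hfin)
    · refine of_forall_exists hx fun δ hδ => ?_
      obtain ⟨k, hk⟩ := exists_nat_one_div_lt hδ
      refine ⟨y (m k), hne _, ?_, (hcc k).mono (subset_iUnion c k)⟩
      have h1 := min_le_right ε (1 / ((k : ℝ) + 1))
      have h2 : 0 < 1 / ((k : ℝ) + 1) := Nat.one_div_pos_of_nat
      linarith [hm k]

/-- A chain point prevents the sets it passes through from being separated. -/
theorem mem_closure_and_infinite {c : ι → Set L} (h : ChainPt G b S x)
    (hc : ∀ i ∈ S, Disjoint (derivedSet (b \ c i)) (G i)) :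
    x ∈ closure (b ∩ ⋂ i ∈ S, c i) ∧ (S.Nonempty → (b ∩ ⋂ i ∈ S, c i).Infinite) := by
  induction h with
  | base hx => exact ⟨subset_closure (by simpa using hx), by simp⟩
  | @limit S x i y hx hne hy _ ih =>
    have hacc : x ∈ derivedSet (b ∩ ⋂ j ∈ S, c j) := by
      rw [← derivedSet_closure, mem_derivedSet, accPt_iff_frequently]
      exact hy.frequently (Eventually.of_forall fun k =>
        ⟨hne k, (ih k fun j hj => hc j (Finset.mem_insert_of_mem hj)).1⟩).frequently
    have hsub : b ∩ ⋂ j ∈ S, c j ⊆ (b ∩ ⋂ j ∈ insert i S, c j) ∪ (b \ c i) := by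
      rintro z ⟨hzb, hz⟩
      by_cases hzi : z ∈ c i
      · left
        rw [Finset.set_biInter_insert]
        exact ⟨hzb, hzi, hz⟩
      · exact Or.inr ⟨hzb, hzi⟩
    have hx_acc : x ∈ derivedSet (b ∩ ⋂ j ∈ insert i S, c j) := by
      have := derivedSet_mono _ _ hsub hacc
      rw [derivedSet_union] at this
      exact this.resolve_right fun h' =>
        disjoint_left.1 (hc i (Finset.mem_insert_self i S)) h' hx
    exact ⟨derivedSet_subset_closure _ hx_acc, fun _ => Set.Infinite.of_accPt hx_acc⟩

/-- If the sets `G i`, `i ∈ A`, cannot be separated on `a`, there is a chain point. -/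
theorem exists_of_not_separated [Finite ι] {a : Set L} {A : Finset ι} (hA : A.Nonempty)
    (hdisj : ∀ i j, i ≠ j → Disjoint (G i) (G j))
    (hgap : ∀ c : ι → Set L, (∀ i ∈ A, Disjoint (derivedSet (a \ c i)) (G i)) →
      (a ∩ ⋂ i ∈ A, c i).Nonempty) :
    ∃ x, ChainPt G a A x := by
  have hr : ∀ x : L, ∃ r > 0, ∀ S : Finset ι,
      (∃ y, y ≠ x ∧ dist y x < 2 * r ∧ ChainPt G a S y) →
      ∀ ε > 0, ∃ y, y ≠ x ∧ dist y x < ε ∧ ChainPt G a S y := by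
    intro x
    have hev : ∀ S : Finset ι, ∀ᶠ r in 𝓝[>] (0 : ℝ),
        (∃ y, y ≠ x ∧ dist y x < 2 * r ∧ ChainPt G a S y) →
        ∀ ε > 0, ∃ y, y ≠ x ∧ dist y x < ε ∧ ChainPt G a S y := by
      intro S
      by_cases hS : ∀ ε > 0, ∃ y, y ≠ x ∧ dist y x < ε ∧ ChainPt G a S y
      · exact Eventually.of_forall fun _ _ => hS
      · push Not at hS
        obtain ⟨ε, hε, hS⟩ := hS
        filter_upwards [Ioo_mem_nhdsGT (half_pos hε)] with r hr
        rintro ⟨y, hyx, hy, hc⟩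
        exact absurd hc (hS y hyx (by linarith [hr.2]))
    obtain ⟨r, hr, hr0⟩ := ((eventually_all.2 hev).and self_mem_nhdsWithin).exists
    exact ⟨r, hr0, hr⟩
  choose r hr0 hr using hr
  obtain ⟨y, hya, hy⟩ := hgap
    (fun i => ⋃ x ∈ G i ∩ derivedSet a, Metric.ball x (r x)) (by
      intro i _
      rw [disjoint_left]
      intro x hx hxi
      obtain ⟨z, ⟨hz, hza, hzn⟩, -⟩ :=
        accPt_iff_nhds.1 hx _ (Metric.ball_mem_nhds x (hr0 x))
      exact hzn (mem_biUnion ⟨hxi, derivedSet_mono _ _ sdiff_subset hx⟩ hz))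
  have : Nonempty L := ⟨y⟩
  have hex : ∀ i ∈ A, ∃ x, (x ∈ G i ∧ x ∈ derivedSet a) ∧ dist y x < r x := by
    intro i hi
    simpa using mem_iInter₂.1 hy i hi
  choose! p hp hpy using hex
  have key : ∀ S ⊆ A, S = ∅ ∨ ∃ j ∈ S, ChainPt G a S (p j) := by
    intro S
    induction S using Finset.induction_on_max_value (fun i => r (p i)) with
    | empty => simp
    | insert i S hi hmax ih =>
      intro hS
      have hiA : i ∈ A := hS (Finset.mem_insert_self i S)
      refine Or.inr ⟨i, Finset.mem_insert_self i S, ?_⟩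
      rcases ih fun j hj => hS (Finset.mem_insert_of_mem hj) with rfl | ⟨j, hj, hjc⟩
      · refine of_forall_exists (hp i hiA).1 fun ε hε => ?_
        obtain ⟨z, ⟨hz, hza⟩, hzx⟩ :=
          accPt_iff_nhds.1 (hp i hiA).2 _ (Metric.ball_mem_nhds _ hε)
        exact ⟨z, hzx, hz, base hza⟩
      · have hjA : j ∈ A := hS (Finset.mem_insert_of_mem hj)
        refine of_forall_exists (hp i hiA).1 (hr _ S ⟨p j, ?_, ?_, hjc⟩)
        · intro heq
          have hji : j ≠ i := fun h => hi (h ▸ hj)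
          exact disjoint_left.1 (hdisj j i hji) (hp j hjA).1 (heq ▸ (hp i hiA).1)
        · have h1 := hmax j hj
          have h2 := hpy i hiA
          have h3 := hpy j hjA
          rw [dist_comm] at h3
          linarith [dist_triangle (p j) y (p i)]
  rcases key A Subset.rfl with h | ⟨j, -, hj⟩
  · exact absurd h hA.ne_empty
  · exact ⟨_, hj⟩

end ChainPt

theorem exists_mem_derivedSet_image_val {L : Type*} [MetricSpace L] [CompactSpace L]
    {D : Set L} {y : Set D} (hy : y.Infinite) : ∃ x, x ∈ derivedSet (Subtype.val '' y) :=
  (hy.image Subtype.val_injective.injOn).exists_accPt_principal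

theorem derivedSet_subset_of_mem_idealIG {L : Type*} [MetricSpace L] {D G : Set L}
    {y : Set D} (hy : y ∈ idealIG D G) : derivedSet (Subtype.val '' y) ⊆ G := by
  rw [← accPts_eq_derivedSet]
  exact hy

/-- A set whose subsets in `idealIG D G` are all finite has no accumulation point in `G`. -/
theorem disjoint_derivedSet_of_forall_finite {L : Type*} [MetricSpace L] {D G : Set L}
    {e : Set D} (he : ∀ y ⊆ e, y ∈ idealIG D G → y.Finite) :
    Disjoint (derivedSet (Subtype.val '' e)) G := by
  rw [disjoint_left]
  intro x hx hxG
  have hchain : ChainPt (fun _ : Unit => G) (Subtype.val '' e) (insert () ∅) x := by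
    refine ChainPt.of_forall_exists hxG fun ε hε => ?_
    obtain ⟨z, ⟨hz, hze⟩, hzx⟩ := accPt_iff_nhds.1 hx _ (Metric.ball_mem_nhds _ hε)
    exact ⟨z, hzx, hz, .base hze⟩
  obtain ⟨b, hbe, -, hbG, hb⟩ := hchain.exists_subset_derivedSet_subset 1 one_pos
  obtain ⟨y, hye, rfl⟩ := subset_image_iff.1 hbe
  have hinf := (hb.mem_closure_and_infinite (c := fun _ => univ) fun i _ => by
    rw [sdiff_univ, disjoint_left]
    exact fun w hw => absurd (Set.Infinite.of_accPt hw) (by simp)).2 (by simp)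
  refine (hinf.mono inter_subset_left) ((he y hye ?_).image _)
  have hyG : derivedSet (Subtype.val '' y) ⊆ G := by simpa [iUnion_const] using hbG
  rwa [← accPts_eq_derivedSet] at hyG

theorem idealLe_restrict_of_disjoint {L : Type*} [MetricSpace L] [CompactSpace L]
    {D G : Set L} {a c : Set D}
    (h : Disjoint (derivedSet (Subtype.val '' (a \ c))) G) :
    IdealLe (Restrict (idealIG D G) a) c := by
  rintro y ⟨hy, hya⟩
  have hfin : (y ∩ (a \ c)).Finite := by
    by_contra hinf
    obtain ⟨x, hx⟩ := exists_mem_derivedSet_image_val hinf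
    exact disjoint_left.1 h (derivedSet_mono _ _ (image_mono inter_subset_right) hx)
      (derivedSet_subset_of_mem_idealIG hy
        (derivedSet_mono _ _ (image_mono inter_subset_left) hx))
  refine (hya.union hfin).subset ?_
  rintro z ⟨hzy, hzc⟩
  by_cases hza : z ∈ a
  · exact Or.inr ⟨hzy, hza, hzc⟩
  · exact Or.inl ⟨hzy, hza⟩

theorem disjoint_of_idealLe_restrict {L : Type*} [MetricSpace L] {D G : Set L}
    {a c : Set D} (h : IdealLe (Restrict (idealIG D G) a) c) :
    Disjoint (derivedSet (Subtype.val '' (a \ c))) G := by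
  refine disjoint_derivedSet_of_forall_finite fun y hy hyG => ?_
  have hya : y \ a = ∅ := sdiff_eq_empty.2 fun z hz => (hy hz).1
  refine (h y ⟨hyG, by simp [hya]⟩).subset fun z hz => ⟨hz, (hy hz).2⟩

/-- If pairwise disjoint sets `G_i ⊆ K = acc(D)` are such that `{I_{G_i} : i < n}` is an
`n`-gap, then this gap is a jigsaw: a `B`-jigsaw for every nonempty proper `B ⊆ n`. -/
theorem idealIG_gap_is_jigsaw
    (L : Type*) [MetricSpace L] [CompactSpace L]
    (D : Set L) (hD : D.Countable)
    (n : ℕ) (G : Fin n → Set L)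
    (hGK : ∀ i, G i ⊆ accPts D)
    (hdisj : ∀ i j : Fin n, i ≠ j → Disjoint (G i) (G j))
    (hgap : IsGap (fun i => idealIG D (G i))) :
    ∀ B : Set (Fin n), B.Nonempty → B ≠ Set.univ →
      IsBJigsaw (fun i => idealIG D (G i)) B := by
  classical
  rintro B hB - A hBA a ⟨horth, hsep⟩
  let A' := A.toFinite.toFinset
  let B' := B.toFinite.toFinset
  have memA : ∀ i, i ∈ A' ↔ i ∈ A := fun i => Set.Finite.mem_toFinset _
  have memB : ∀ i, i ∈ B' ↔ i ∈ B := fun i => Set.Finite.mem_toFinset _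
  have hBne : B'.Nonempty := hB.imp fun i hi => (memB i).2 hi
  have hBA' : B' ⊆ A' := fun i hi => (memA i).2 (hBA ((memB i).1 hi))
  obtain ⟨x₀, hx₀⟩ : ∃ x, ChainPt G (Subtype.val '' a) A' x := by
    refine ChainPt.exists_of_not_separated (hBne.mono hBA') hdisj fun c hc => ?_
    obtain ⟨z, hz⟩ := (hsep (fun i => a ∩ Subtype.val ⁻¹' c i) fun i hi => by
      refine idealLe_restrict_of_disjoint ((hc i ((memA i).2 hi)).mono_left ?_)
      refine derivedSet_mono _ _ ?_
      rintro _ ⟨z, ⟨hza, hzc⟩, rfl⟩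
      exact ⟨⟨z, hza, rfl⟩, fun h => hzc ⟨hza, h⟩⟩).nonempty
    rw [mem_iInter₂] at hz
    obtain ⟨i, hi⟩ := hB
    exact ⟨z, ⟨z, (hz i (hBA hi)).1, rfl⟩,
      mem_iInter₂.2 fun j hj => (hz j ((memA j).1 hj)).2⟩
  obtain ⟨x, -, hx⟩ := hx₀.exists_near_of_subset B' hBA' 1 one_pos
  obtain ⟨b', hb'a, -, hacc, hb⟩ := hx.exists_subset_derivedSet_subset 1 one_pos
  obtain ⟨b, hba, rfl⟩ := subset_image_iff.1 hb'a
  refine ⟨b, hba, ⟨?_, fun c hc => ?_⟩, ?_⟩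
  · intro i hi j hj hij y hy z hz
    exact horth i (hBA hi) j (hBA hj) hij
      y ⟨hy.1, hy.2.subset (sdiff_subset_sdiff_right hba)⟩
      z ⟨hz.1, hz.2.subset (sdiff_subset_sdiff_right hba)⟩
  · have hinf := (hb.mem_closure_and_infinite (c := fun i => Subtype.val '' c i) fun i hi => by
      rw [← image_sdiff Subtype.val_injective]
      exact disjoint_of_idealLe_restrict (hc i ((memB i).1 hi))).2 hBne
    refine Set.Infinite.of_image Subtype.val (hinf.mono ?_)
    rintro _ ⟨⟨z, -, rfl⟩, hz⟩
    refine ⟨z, mem_iInter₂.2 fun i hi => ?_, rfl⟩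
    obtain ⟨w, hw, hwz⟩ := mem_iInter₂.1 hz i ((memB i).2 hi)
    exact Subtype.val_injective hwz ▸ hw
  · rintro i ⟨-, hiB⟩ y hy
    by_contra hinf
    obtain ⟨p, hp⟩ := exists_mem_derivedSet_image_val hinf
    have h1 := derivedSet_subset_of_mem_idealIG hy
      (derivedSet_mono _ _ (image_mono inter_subset_right) hp)
    obtain ⟨j, hj, h2⟩ := mem_iUnion₂.1
      (hacc (derivedSet_mono _ _ (image_mono inter_subset_left) hp))
    have hij : i ≠ j := fun h => hiB (h ▸ (memB j).1 hj)
    exact disjoint_left.1 (hdisj i j hij) h1 h2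
end
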